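/- arXiv:1207.6522 — 6 statements merged into one kernel-verified Lean document; each statement's English description precedes it below -/
import Mathlib

section
/- The shifted concatenation of two packed words is again a packed word, the operation * is associative on words (for all words u, v, w one has (u*v)*w = u*(v*w)), and the empty word is a two-sided unit for *. Consequently the k-vector space H spanned by the packed words, with product the linear extension of *, is an associative unital algebra (with unit the empty word). -/
/-- Words over the alphabet `X = {x_i : i ≥ 0}`, identified with lists of natural numbers. -/
abbrev Word : Type := List ℕ

/-- `IAlph w` is the set of indices of letters occurring in `w`. -/
def IAlph (w : Word) : Finset ℕ := w.toFinset

/-- `wsup w` is the supremum of `IAlph w` (0 for the empty word). -/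
def wsup (w : Word) : ℕ := w.foldr max 0

/-- The substitution `S_φ` replaces each letter `x_i` by `x_{φ i}`. -/
def subst (φ : ℕ → ℕ) (w : Word) : Word := w.map φ

/-- The packing substitution `φ_w`: it sends the `m`-th smallest nonzero letter of `w` to `m`,
and `0` to `0`. -/
def packMap (w : Word) (i : ℕ) : ℕ := (((IAlph w).erase 0).filter (fun j => j ≤ i)).card

/-- `pack w = S_{φ_w} w`. -/
def pack (w : Word) : Word := subst (packMap w) w

/-- A word is packed if `pack w = w`. -/
def IsPacked (w : Word) : Prop := pack w = w

/-- `T_t`: shift every nonzero letter by `t`, fixing `x_0`. -/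
def shiftW (t : ℕ) (w : Word) : Word := subst (fun n => if n = 0 then 0 else n + t) w

/-- Shifted concatenation `u * v = u · T_{sup u}(v)`. -/
def sc (u v : Word) : Word := u ++ shiftW (wsup u) v

/-- `w[I]`: the subword of `w` formed by the letters at the (1-indexed) positions in `I`,
taken in increasing order of position. -/
def subword (w : Word) (I : Finset ℕ) : Word :=
  ((List.range w.length).filter (fun j => decide (j + 1 ∈ I))).map (fun j => w.getD j 0)

/-- Quotient by a set of indices: `w / A = S_{φ_A} w` where `φ_A i = 0` if `i ∈ A`, else `i`. -/
def quotSet (w : Word) (A : Finset ℕ) : Word := subst (fun i => if i ∈ A then 0 else i) w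

/-- Quotient by a word: `w / u = w / IAlph u`. -/
def quotWord (w u : Word) : Word := quotSet w (IAlph u)

theorem le_wsup {w : Word} {i : ℕ} (h : i ∈ w) : i ≤ wsup w := by
  induction w with
  | nil => simp at h
  | cons a w ih =>
    simp only [wsup, List.foldr_cons] at ih ⊢
    rcases List.mem_cons.1 h with rfl | h
    · exact le_max_left _ _
    · exact (ih h).trans (le_max_right _ _)

theorem wsup_mem {w : Word} (h : wsup w ≠ 0) : wsup w ∈ w := by
  induction w with
  | nil => simp [wsup] at h
  | cons a w ih =>
    simp only [wsup, List.foldr_cons] at ih h ⊢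
    rcases max_cases a (w.foldr max 0) with ⟨h', _⟩ | ⟨h', _⟩
    · simp [h']
    · rw [h'] at h ⊢
      exact List.mem_cons_of_mem _ (ih h)

theorem wsup_append (u v : Word) : wsup (u ++ v) = max (wsup u) (wsup v) := by
  induction u with
  | nil => simp [wsup]
  | cons a u ih =>
    simp only [wsup, List.cons_append, List.foldr_cons] at ih ⊢
    rw [ih, max_assoc]

theorem wsup_shiftW (t : ℕ) (v : Word) :
    wsup (shiftW t v) = if wsup v = 0 then 0 else wsup v + t := by
  induction v with
  | nil => simp [wsup, shiftW, subst]
  | cons a v ih =>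
    simp only [wsup, shiftW, subst, List.map_cons, List.foldr_cons] at ih ⊢
    grind

theorem wsup_sc (u v : Word) : wsup (sc u v) = wsup u + wsup v := by
  rw [sc, wsup_append, wsup_shiftW]
  split_ifs <;> omega

theorem shiftW_append (t : ℕ) (u v : Word) : shiftW t (u ++ v) = shiftW t u ++ shiftW t v := by
  simp [shiftW, subst]

theorem shiftW_shiftW (s t : ℕ) (w : Word) : shiftW s (shiftW t w) = shiftW (s + t) w := by
  simp only [shiftW, subst, List.map_map]
  refine List.map_congr_left fun n _ => ?_
  simp only [Function.comp_apply]
  split_ifs <;> omega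

theorem sc_assoc (u v w : Word) : sc (sc u v) w = sc u (sc v w) := by
  rw [sc, wsup_sc, sc, sc, sc, shiftW_append, shiftW_shiftW, List.append_assoc]

theorem sc_nil (u : Word) : sc u [] = u := by
  simp [sc, shiftW, subst]

theorem nil_sc (u : Word) : sc [] u = u := by
  simp only [sc, shiftW, subst, wsup, List.nil_append, List.foldr_nil, Nat.add_zero]
  exact (List.map_congr_left fun n _ => by grind).trans (List.map_id u)

/-- A word is packed if and only if its nonzero letters fill an initial segment. -/
theorem isPacked_iff (w : Word) : IsPacked w ↔ ∀ i, 0 < i → i ≤ wsup w → i ∈ w := by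
  have pack_iff : IsPacked w ↔ ∀ i ∈ w, packMap w i = i := by
    simp only [IsPacked, pack, subst]
    simpa using List.map_inj_left (l := w) (f := packMap w) (g := id)
  rw [pack_iff]
  constructor
  · intro h i hi hiw
    have hm := h _ (wsup_mem (by omega))
    have hsub : ((IAlph w).erase 0).filter (fun j => j ≤ wsup w) ⊆ Finset.Icc 1 (wsup w) := by
      intro j hj
      simp only [Finset.mem_filter, Finset.mem_erase] at hj
      simp only [Finset.mem_Icc]
      omega
    have heq := Finset.eq_of_subset_of_card_le hsub (by rw [Nat.card_Icc]; exact hm.ge)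
    have hmem : i ∈ Finset.Icc 1 (wsup w) := Finset.mem_Icc.2 ⟨hi, hiw⟩
    rw [← heq] at hmem
    simp only [Finset.mem_filter, Finset.mem_erase, IAlph, List.mem_toFinset] at hmem
    exact hmem.1.2
  · intro h i hi
    have heq : ((IAlph w).erase 0).filter (fun j => j ≤ i) = Finset.Icc 1 i := by
      ext j
      simp only [Finset.mem_filter, Finset.mem_erase, IAlph, List.mem_toFinset, Finset.mem_Icc]
      constructor
      · omega
      · intro hj
        exact ⟨⟨by omega, h j (by omega) (hj.2.trans (le_wsup hi))⟩, hj.2⟩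
    rw [packMap, heq, Nat.card_Icc, Nat.add_sub_cancel]

theorem IsPacked.sc {u v : Word} (hu : IsPacked u) (hv : IsPacked v) : IsPacked (sc u v) := by
  rw [isPacked_iff] at hu hv ⊢
  intro i hi hiw
  rw [wsup_sc] at hiw
  rw [_root_.sc, List.mem_append]
  rcases le_or_gt i (wsup u) with h | h
  · exact Or.inl (hu i hi h)
  · refine Or.inr (List.mem_map.2 ⟨i - wsup u, hv _ (by omega) (by omega), ?_⟩)
    rw [if_neg (by omega)]
    omega

/-- Packed words form a monoid under shifted concatenation. -/
instance packedWordMonoid : Monoid {w : Word // IsPacked w} where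
  mul u v := ⟨sc u.1 v.1, u.2.sc v.2⟩
  one := ⟨[], rfl⟩
  mul_assoc u v w := Subtype.ext (sc_assoc u.1 v.1 w.1)
  one_mul u := Subtype.ext (nil_sc u.1)
  mul_one u := Subtype.ext (sc_nil u.1)

/-- The shifted concatenation of packed words is packed, `*` is associative
with the empty word as a two-sided unit, and consequently the `k`-vector space `H` spanned by
the packed words, with product the linear extension of `*`, is an associative unital
`k`-algebra with unit the (class of the) empty word. -/
theorem wmat_is_algebra (k : Type) [Field k] :
    (∀ u v : Word, IsPacked u → IsPacked v → IsPacked (sc u v)) ∧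
    (∀ u v w : Word, sc (sc u v) w = sc u (sc v w)) ∧
    (∀ u : Word, sc u [] = u ∧ sc [] u = u) ∧
    (∃ (R : Ring ({w : Word // IsPacked w} →₀ k))
        (_ : @Algebra k ({w : Word // IsPacked w} →₀ k) inferInstance R.toSemiring),
      (∀ (u v : {w : Word // IsPacked w}) (a b : k),
        ∃ p : {w : Word // IsPacked w}, p.1 = sc u.1 v.1 ∧
          @HMul.hMul _ _ _ (@instHMul _ R.toMul)
              (Finsupp.single u a) (Finsupp.single v b)
            = Finsupp.single p (a * b)) ∧
      @One.one _ R.toOne = Finsupp.single ⟨([] : Word), rfl⟩ (1 : k)) := by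
  refine ⟨fun _ _ hu hv => hu.sc hv, sc_assoc, fun u => ⟨sc_nil u, nil_sc u⟩, ?_⟩
  let e : ({w : Word // IsPacked w} →₀ k) ≃ MonoidAlgebra k {w : Word // IsPacked w} :=
    MonoidAlgebra.coeffEquiv.symm
  refine ⟨e.ring, e.algebra k, fun u v a b => ⟨u * v, rfl, ?_⟩, rfl⟩
  exact congrArg MonoidAlgebra.coeff (MonoidAlgebra.single_mul_single u v a b)
end

section
/- The packing map is a morphism of monoids for shifted concatenation: for all words u and v, pack(u*v) = pack(u) * pack(v), and pack of the empty word is the empty word. Hence pack extends to a morphism of associative unital algebras from the algebra of all words under shifted concatenation to the algebra H of packed words. -/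
/-- The product on the span of words: the bilinear extension of the shifted concatenation. -/
noncomputable def Hmul (k : Type) [Field k] (f g : Word →₀ k) : Word →₀ k :=
  f.sum fun u a => g.sum fun v b => Finsupp.single (sc u v) (a * b)

/-- The linear extension of `pack` to the span of words (landing in the span `H` of packed
words). -/
noncomputable def packL (k : Type) [Field k] (f : Word →₀ k) : Word →₀ k :=
  f.sum fun w a => Finsupp.single (pack w) a

theorem mem_IAlph {w : Word} {i : ℕ} : i ∈ IAlph w ↔ i ∈ w := List.mem_toFinset

theorem wsup_le {w : Word} {n : ℕ} (h : ∀ i ∈ w, i ≤ n) : wsup w ≤ n := by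
  induction w with
  | nil => exact Nat.zero_le n
  | cons a w ih =>
    simp only [wsup, List.foldr_cons, List.forall_mem_cons] at *
    exact max_le h.1 (ih h.2)

theorem packMap_zero (w : Word) : packMap w 0 = 0 := by
  simp +contextual [packMap, Finset.filter_eq_empty_iff]

theorem packMap_mono (w : Word) : Monotone (packMap w) := fun _ _ hij =>
  Finset.card_le_card fun _ hx => by
    simp only [Finset.mem_filter] at hx ⊢
    exact ⟨hx.1, hx.2.trans hij⟩

theorem packMap_lt {w : Word} {i j : ℕ} (hij : i < j) (hj : j ∈ w) :
    packMap w i < packMap w j := by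
  refine Finset.card_lt_card (Finset.ssubset_iff_of_subset ?_ |>.2 ⟨j, ?_, ?_⟩)
  · intro x hx
    simp only [Finset.mem_filter] at hx ⊢
    exact ⟨hx.1, hx.2.trans hij.le⟩
  · simp only [Finset.mem_filter, Finset.mem_erase, mem_IAlph]
    exact ⟨⟨by omega, hj⟩, le_rfl⟩
  · simp [hij]

theorem packMap_eq_zero {w : Word} {i : ℕ} (hi : i ∈ w) : packMap w i = 0 ↔ i = 0 := by
  refine ⟨fun h => ?_, fun h => h ▸ packMap_zero w⟩
  by_contra h0
  have := packMap_lt (Nat.pos_of_ne_zero h0) hi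
  omega

theorem packMap_injOn (w : Word) : Set.InjOn (packMap w) {i | i ∈ w} := by
  intro i hi j hj h
  rcases lt_trichotomy i j with hlt | rfl | hlt
  · exact absurd h (packMap_lt hlt hj).ne
  · rfl
  · exact absurd h (packMap_lt hlt hi).ne'

theorem packMap_le_iff {w : Word} {i j : ℕ} (hj : j ∈ w) :
    packMap w j ≤ packMap w i ↔ j ≤ i := by
  refine ⟨fun h => ?_, fun h => packMap_mono w h⟩
  by_contra hlt
  exact absurd h (not_le.2 (packMap_lt (not_le.1 hlt) hj))

theorem packMap_pack (w : Word) (i : ℕ) : packMap (pack w) (packMap w i) = packMap w i := by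
  have h : ((IAlph (pack w)).erase 0).filter (fun j => j ≤ packMap w i) =
      (((IAlph w).erase 0).filter (fun j => j ≤ i)).image (packMap w) := by
    ext x
    simp only [Finset.mem_filter, Finset.mem_erase, mem_IAlph, pack, subst, List.mem_map,
      Finset.mem_image]
    constructor
    · rintro ⟨⟨hx, j, hj, rfl⟩, hle⟩
      exact ⟨j, ⟨⟨fun h => hx ((packMap_eq_zero hj).2 h), hj⟩, (packMap_le_iff hj).1 hle⟩, rfl⟩
    · rintro ⟨j, ⟨⟨h0, hj⟩, hle⟩, rfl⟩
      exact ⟨⟨fun h => h0 ((packMap_eq_zero hj).1 h), j, hj, rfl⟩, packMap_mono w hle⟩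
  rw [packMap, h, Finset.card_image_of_injOn, ← packMap]
  refine (packMap_injOn w).mono fun j hj => ?_
  simp only [Finset.coe_filter, Finset.mem_erase, mem_IAlph] at hj
  exact hj.1.2

theorem isPacked_pack (w : Word) : IsPacked (pack w) := by
  change subst (packMap (pack w)) (subst (packMap w) w) = subst (packMap w) w
  rw [subst, subst, List.map_map]
  exact List.map_congr_left fun i _ => packMap_pack w i

theorem packMap_of_wsup_le {w : Word} {i : ℕ} (h : wsup w ≤ i) :
    packMap w i = ((IAlph w).erase 0).card := by
  rw [packMap, Finset.filter_true_of_mem]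
  intro j hj
  exact (le_wsup (mem_IAlph.1 (Finset.mem_of_mem_erase hj))).trans h

theorem wsup_pack (w : Word) : wsup (pack w) = ((IAlph w).erase 0).card := by
  rw [← packMap_of_wsup_le le_rfl]
  refine le_antisymm (wsup_le fun i hi => ?_) ?_
  · obtain ⟨j, hj, rfl⟩ := List.mem_map.1 hi
    exact packMap_mono w (le_wsup hj)
  · rcases eq_or_ne (wsup w) 0 with h | h
    · rw [h, packMap_zero]
      exact Nat.zero_le _
    · exact le_wsup (List.mem_map_of_mem (wsup_mem h))

theorem mem_sc {u v : Word} {x : ℕ} :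
    x ∈ sc u v ↔ x ∈ u ∨ ∃ j ∈ v, (if j = 0 then 0 else j + wsup u) = x := by
  simp only [sc, shiftW, subst, List.mem_append, List.mem_map]

theorem packMap_sc_of_le {u v : Word} {i : ℕ} (h : i ≤ wsup u) :
    packMap (sc u v) i = packMap u i := by
  unfold packMap
  congr 1
  ext x
  simp only [Finset.mem_filter, Finset.mem_erase, mem_IAlph, mem_sc]
  constructor
  · rintro ⟨⟨hx, hu | ⟨j, -, rfl⟩⟩, hle⟩
    · exact ⟨⟨hx, hu⟩, hle⟩
    · split_ifs at hx hle <;> omega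
  · rintro ⟨⟨hx, hu⟩, hle⟩
    exact ⟨⟨hx, Or.inl hu⟩, hle⟩

theorem packMap_sc_add (u v : Word) (i : ℕ) :
    packMap (sc u v) (i + wsup u) = packMap v i + ((IAlph u).erase 0).card := by
  have h : ((IAlph (sc u v)).erase 0).filter (fun j => j ≤ i + wsup u) =
      (((IAlph v).erase 0).filter (fun j => j ≤ i)).map (addRightEmbedding (wsup u)) ∪
        (IAlph u).erase 0 := by
    ext x
    simp only [Finset.mem_filter, Finset.mem_erase, mem_IAlph, mem_sc, Finset.mem_union,
      Finset.mem_map, addRightEmbedding_apply]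
    constructor
    · rintro ⟨⟨hx, hu | ⟨j, hj, rfl⟩⟩, hle⟩
      · exact Or.inr ⟨hx, hu⟩
      · split_ifs at hx hle ⊢ with h0
        · exact absurd rfl hx
        · exact Or.inl ⟨j, ⟨⟨h0, hj⟩, by omega⟩, rfl⟩
    · rintro (⟨j, ⟨⟨h0, hj⟩, hle⟩, rfl⟩ | ⟨hx, hu⟩)
      · exact ⟨⟨by omega, Or.inr ⟨j, hj, if_neg h0⟩⟩, by omega⟩
      · exact ⟨⟨hx, Or.inl hu⟩, (le_wsup hu).trans (Nat.le_add_left _ _)⟩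
  rw [packMap, h, Finset.card_union_of_disjoint, Finset.card_map, ← packMap]
  rw [Finset.disjoint_left]
  intro x hx hu
  simp only [Finset.mem_filter, Finset.mem_erase, mem_IAlph,
    Finset.mem_map, addRightEmbedding_apply] at hx hu
  obtain ⟨j, ⟨⟨h0, -⟩, -⟩, rfl⟩ := hx
  have := le_wsup hu.2
  omega

theorem pack_sc (u v : Word) : pack (sc u v) = sc (pack u) (pack v) := by
  have hu : subst (packMap (sc u v)) u = pack u :=
    List.map_congr_left fun i hi => packMap_sc_of_le (le_wsup hi)
  have hv : subst (packMap (sc u v)) (shiftW (wsup u) v) = shiftW (wsup (pack u)) (pack v) := by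
    simp only [shiftW, pack, subst, List.map_map]
    refine List.map_congr_left fun i hi => ?_
    simp only [Function.comp_apply, packMap_eq_zero hi]
    split_ifs with h0
    · exact packMap_zero _
    · rw [packMap_sc_add, ← wsup_pack]
      rfl
  calc pack (sc u v)
      = subst (packMap (sc u v)) u ++ subst (packMap (sc u v)) (shiftW (wsup u) v) :=
        List.map_append
    _ = sc (pack u) (pack v) := by rw [hu, hv, sc]

theorem packL_eq_mapDomain (k : Type) [Field k] (f : Word →₀ k) :
    packL k f = f.mapDomain pack := rfl

theorem packL_Hmul (k : Type) [Field k] (f g : Word →₀ k) :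
    packL k (Hmul k f g) = Hmul k (packL k f) (packL k g) := by
  simp only [packL_eq_mapDomain, Hmul]
  rw [Finsupp.sum_mapDomain_index (by simp)
    (by intros; simp only [add_mul, Finsupp.single_add, Finsupp.sum_add]), Finsupp.mapDomain_sum]
  refine Finsupp.sum_congr fun u _ => ?_
  rw [Finsupp.sum_mapDomain_index (by simp)
    (by intros; simp only [mul_add, Finsupp.single_add]), Finsupp.mapDomain_sum]
  refine Finsupp.sum_congr fun v _ => ?_
  rw [Finsupp.mapDomain_single, pack_sc]

/-- `pack` is a morphism of monoids for the shifted concatenation: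
`pack(u*v) = pack(u)*pack(v)` and `pack(1) = 1`; its image consists of packed words; hence its
linear extension is a morphism of associative unital algebras from the algebra of all words
(under shifted concatenation) to the algebra `H` of packed words. -/
theorem pack_is_morphism (k : Type) [Field k] :
    (∀ u v : Word, pack (sc u v) = sc (pack u) (pack v)) ∧
    pack ([] : Word) = ([] : Word) ∧
    (∀ w : Word, IsPacked (pack w)) ∧
    (∀ f g : Word →₀ k, packL k (Hmul k f g) = Hmul k (packL k f) (packL k g)) ∧
    packL k (Finsupp.single ([] : Word) (1 : k)) = Finsupp.single ([] : Word) (1 : k) := by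
  refine ⟨pack_sc, rfl, isPacked_pack, packL_Hmul k, ?_⟩
  rw [packL_eq_mapDomain, Finsupp.mapDomain_single]
  rfl
end

section
/- Let w be a word, I ⊆ {1,...,|w|}, and I₁ ⊆ {1,...,|I|}. Let α : I → {1,...,|I|} be the order-preserving bijection sending the s-th smallest element of I to s, and let I'₁ = α⁻¹(I₁). Then pack(w[I])[I₁] = S_{φ_{w[I]}}(w[I'₁]), where φ_{w[I]} is the packing substitution of the word w[I]. -/
/-- The positions kept by `subword`, shifted to be 1-indexed, are the sorted list of `I`. -/
theorem map_succ_filter_range_eq_sort {n : ℕ} {I : Finset ℕ} (hI : I ⊆ Finset.Icc 1 n) :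
    ((List.range n).filter (fun j => decide (j + 1 ∈ I))).map (· + 1) = I.sort (· ≤ ·) := by
  refine List.SortedLT.eq_of_mem_iff (List.Pairwise.sortedLT ?_) I.sortedLT_sort fun a => ?_
  · exact (List.pairwise_lt_range.filter _).map _ fun a b h => Nat.succ_lt_succ h
  · simp only [List.mem_map, List.mem_filter, List.mem_range, decide_eq_true_eq, Finset.mem_sort]
    constructor
    · rintro ⟨j, ⟨-, hj⟩, rfl⟩
      exact hj
    · intro ha
      have h := Finset.mem_Icc.1 (hI ha)
      have e : a - 1 + 1 = a := by omega
      exact ⟨a - 1, ⟨by omega, e.symm ▸ ha⟩, e⟩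

theorem subword_eq_map_sort {w : Word} {I : Finset ℕ} (hI : I ⊆ Finset.Icc 1 w.length) :
    subword w I = (I.sort (· ≤ ·)).map fun j => w.getD (j - 1) 0 := by
  rw [← map_succ_filter_range_eq_sort hI, List.map_map]
  rfl

theorem length_subword {w : Word} {I : Finset ℕ} (hI : I ⊆ Finset.Icc 1 w.length) :
    (subword w I).length = I.card := by
  rw [subword_eq_map_sort hI, List.length_map, Finset.length_sort]

theorem subword_subst (φ : ℕ → ℕ) (w : Word) (I : Finset ℕ) :
    subword (subst φ w) I = subst φ (subword w I) := by
  simp only [subword, subst, List.length_map, List.map_map]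
  refine List.map_congr_left fun j hj => ?_
  have hj' : j < w.length := List.mem_range.1 (List.mem_filter.1 hj).1
  simp [hj']

theorem strictMonoOn_sort_getD (I : Finset ℕ) :
    StrictMonoOn (fun s => (I.sort (· ≤ ·)).getD (s - 1) 0) (Finset.Icc 1 I.card : Finset ℕ) := by
  intro s hs t ht hst
  rw [Finset.mem_coe, Finset.mem_Icc] at hs ht
  have hs' : s - 1 < (I.sort (· ≤ ·)).length := by rw [Finset.length_sort]; omega
  have ht' : t - 1 < (I.sort (· ≤ ·)).length := by rw [Finset.length_sort]; omega
  simp only [List.getD_eq_getElem _ _ hs', List.getD_eq_getElem _ _ ht']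
  exact I.sortedLT_sort.getElem_lt_getElem_iff.2 (by omega)

/-- Taking a subword of a subword amounts to taking the subword at the corresponding positions. -/
theorem subword_subword {w : Word} {I I₁ : Finset ℕ}
    (hI : I ⊆ Finset.Icc 1 w.length) (hI₁ : I₁ ⊆ Finset.Icc 1 I.card) :
    subword (subword w I) I₁
      = subword w (I₁.image fun s => (I.sort (· ≤ ·)).getD (s - 1) 0) := by
  have hlt : ∀ s ∈ I₁, s - 1 < (I.sort (· ≤ ·)).length := fun s hs => by
    have := Finset.mem_Icc.1 (hI₁ hs)
    rw [Finset.length_sort]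
    omega
  have himage : (I₁.image fun s => (I.sort (· ≤ ·)).getD (s - 1) 0) ⊆ Finset.Icc 1 w.length := by
    refine Finset.image_subset_iff.2 fun s hs => hI ?_
    rw [List.getD_eq_getElem _ _ (hlt s hs), ← Finset.mem_sort (· ≤ ·)]
    exact List.getElem_mem _
  have hsort : (I₁.image fun s => (I.sort (· ≤ ·)).getD (s - 1) 0).sort (· ≤ ·)
      = (I₁.sort (· ≤ ·)).map fun s => (I.sort (· ≤ ·)).getD (s - 1) 0 := by
    refine List.SortedLT.eq_of_mem_iff (Finset.sortedLT_sort _) (List.Pairwise.sortedLT ?_)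
      fun a => by simp
    refine List.pairwise_map.2 (I₁.sortedLT_sort.pairwise.imp_of_mem fun hs ht hst => ?_)
    exact strictMonoOn_sort_getD I (hI₁ ((Finset.mem_sort _).1 hs))
      (hI₁ ((Finset.mem_sort _).1 ht)) hst
  rw [subword_eq_map_sort himage, hsort, List.map_map,
    subword_eq_map_sort (by rwa [length_subword hI])]
  refine List.map_congr_left fun s hs => ?_
  have h := hlt s ((Finset.mem_sort _).1 hs)
  rw [subword_eq_map_sort hI, List.getD_eq_getElem _ _ (by rwa [List.length_map]),
    List.getElem_map, Function.comp_apply, List.getD_eq_getElem _ _ h]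

/-- Let `w` be a word, `I ⊆ {1,…,|w|}` and `I₁ ⊆ {1,…,|I|}`.  Let
`α : I → {1,…,|I|}` be the order-preserving bijection sending the `s`-th smallest element of `I`
to `s` (so `α⁻¹ s` is the `s`-th smallest element of `I`, i.e. the `(s-1)`-th entry of the sorted
list of `I`), and `I'₁ = α⁻¹(I₁)`.  Then `pack(w[I])[I₁] = S_{φ_{w[I]}}(w[I'₁])`. -/
theorem subword_pack_subword (w : Word) (I I₁ : Finset ℕ)
    (hI : I ⊆ Finset.Icc 1 w.length) (hI₁ : I₁ ⊆ Finset.Icc 1 I.card) :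
    subword (pack (subword w I)) I₁
      = subst (packMap (subword w I))
          (subword w (I₁.image fun s => (I.sort (· ≤ ·)).getD (s - 1) 0)) := by
  rw [pack, subword_subst, subword_subword hI hI₁]
end

section
/- Let w₁, w₂ be words and φ : ℕ → ℕ a map with φ(0) = 0 that is strictly increasing on IAlph(w₁) ∪ IAlph(w₂). Then S_φ(w₁/w₂) = S_φ(w₁)/S_φ(w₂). -/
/-- If `φ : ℕ → ℕ` fixes `0` and is strictly increasing on
`IAlph w₁ ∪ IAlph w₂`, then `S_φ (w₁ / w₂) = (S_φ w₁) / (S_φ w₂)`. -/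
theorem subst_quotWord (w₁ w₂ : Word) (φ : ℕ → ℕ) (h0 : φ 0 = 0)
    (hmono : StrictMonoOn φ (↑(IAlph w₁ ∪ IAlph w₂) : Set ℕ)) :
    subst φ (quotWord w₁ w₂) = quotWord (subst φ w₁) (subst φ w₂) := by
  have mem_iff : ∀ i ∈ w₁, (φ i ∈ IAlph (subst φ w₂) ↔ i ∈ IAlph w₂) := by
    intro i hi
    simp only [IAlph, subst, List.mem_toFinset, List.mem_map]
    constructor
    · rintro ⟨j, hj, hji⟩
      exact hmono.injOn (by simp [IAlph, hj]) (by simp [IAlph, hi]) hji ▸ hj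
    · exact fun h => ⟨i, h, rfl⟩
  unfold quotWord quotSet
  conv_lhs => unfold subst
  conv_rhs => rw [subst, subst.eq_def φ w₁]
  rw [List.map_map, List.map_map]
  refine List.map_congr_left fun i hi => ?_
  simp only [Function.comp_apply, mem_iff i hi, apply_ite φ, h0]
end

section
/- The coproduct Δ on H defined by Δ(w) = Σ_{I ⊔ J = {1,...,|w|}} pack(w[I]) ⊗ pack(w[J]/w[I]) (sum over all ordered partitions of the position set {1,...,|w|} into two disjoint, possibly empty, subsets I and J) is coassociative: (Δ ⊗ Id)∘Δ = (Id ⊗ Δ)∘Δ on H. -/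
/-- The coproduct on basis words, with values in `H ⊗ H` identified with the free vector
space on pairs of words:
`Δ(w) = Σ_{I ⊔ J = {1,…,|w|}} pack(w[I]) ⊗ pack(w[J]/w[I])`. -/
noncomputable def coprod (k : Type) [Field k] (w : Word) : (Word × Word) →₀ k :=
  ∑ I ∈ (Finset.Icc 1 w.length).powerset,
    Finsupp.single
      (pack (subword w I),
        pack (quotWord (subword w (Finset.Icc 1 w.length \ I)) (subword w I)))
      (1 : k)

/-- The sum of `f u v` over all ways of splitting `w` into complementary subwords `u` and `v`. -/
def splitSum {M : Type*} [AddCommMonoid M] : Word → (Word → Word → M) → M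
  | [], f => f [] []
  | a :: w, f => splitSum w (fun u v => f (a :: u) v) + splitSum w (fun u v => f u (a :: v))

section splitSum

variable {M : Type*} [AddCommMonoid M]

theorem splitSum_append_singleton (w : Word) (a : ℕ) (f : Word → Word → M) :
    splitSum (w ++ [a]) f =
      splitSum w (fun u v => f (u ++ [a]) v) + splitSum w (fun u v => f u (v ++ [a])) := by
  induction w generalizing f with
  | nil => simp [splitSum]
  | cons b w ih =>
    simp only [List.cons_append, splitSum, ih]
    exact add_add_add_comm _ _ _ _

theorem splitSum_add (w : Word) (f g : Word → Word → M) :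
    splitSum w (fun u v => f u v + g u v) = splitSum w f + splitSum w g := by
  induction w generalizing f g with
  | nil => rfl
  | cons a w ih =>
    simp only [splitSum, ih]
    exact add_add_add_comm _ _ _ _

theorem splitSum_map (φ : ℕ → ℕ) (w : Word) (f : Word → Word → M) :
    splitSum (w.map φ) f = splitSum w (fun u v => f (u.map φ) (v.map φ)) := by
  induction w generalizing f with
  | nil => rfl
  | cons a w ih => simp only [List.map_cons, splitSum, ih]

theorem splitSum_congr (w : Word) {f g : Word → Word → M}
    (h : ∀ u v, IAlph w = IAlph u ∪ IAlph v → f u v = g u v) :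
    splitSum w f = splitSum w g := by
  induction w generalizing f g with
  | nil => exact h [] [] rfl
  | cons a w ih =>
    simp only [splitSum]
    congr 1
    · refine ih fun u v huv => h _ _ ?_
      simp only [IAlph, List.toFinset_cons] at huv ⊢
      rw [huv, Finset.insert_union]
    · refine ih fun u v huv => h _ _ ?_
      simp only [IAlph, List.toFinset_cons] at huv ⊢
      rw [huv, Finset.union_insert]

theorem splitSum_assoc (w : Word) (g : Word → Word → Word → M) :
    splitSum w (fun u v => splitSum u (fun x y => g x y v)) =
      splitSum w (fun u v => splitSum v (fun x y => g u x y)) := by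
  induction w generalizing g with
  | nil => rfl
  | cons a w ih =>
    simp only [splitSum, splitSum_add, ih, add_assoc]

theorem map_splitSum {N : Type*} [AddCommMonoid N] (F : M →+ N) (w : Word)
    (f : Word → Word → M) : F (splitSum w f) = splitSum w (fun u v => F (f u v)) := by
  induction w generalizing f with
  | nil => rfl
  | cons a w ih => simp only [splitSum, map_add, ih]

theorem subword_append_singleton (w : Word) (a : ℕ) (I : Finset ℕ) :
    subword (w ++ [a]) I = subword w I ++ if w.length + 1 ∈ I then [a] else [] := by
  unfold subword
  rw [List.length_append, List.length_singleton, List.range_succ, List.filter_append,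
    List.map_append]
  congr 1
  · refine List.map_congr_left fun j hj => ?_
    have hj' : j < w.length := by simpa using List.mem_of_mem_filter hj
    simp [List.getElem?_append_left hj']
  · split_ifs with h <;> simp [h]

theorem subword_congr (w : Word) {I J : Finset ℕ}
    (h : ∀ i ∈ Finset.Icc 1 w.length, i ∈ I ↔ i ∈ J) : subword w I = subword w J := by
  unfold subword
  congr 1
  refine List.filter_congr fun j hj => ?_
  have hj' : j < w.length := by simpa using hj
  have := h (j + 1) (by simp; omega)
  simp [this]

theorem sum_powerset_subword (w : Word) (f : Word → Word → M) :
    ∑ I ∈ (Finset.Icc 1 w.length).powerset,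
        f (subword w I) (subword w (Finset.Icc 1 w.length \ I)) = splitSum w f := by
  induction w using List.reverseRecOn generalizing f with
  | nil => simp [splitSum, subword]
  | append_singleton w a ih =>
    have hI : Finset.Icc 1 (w ++ [a]).length = insert (w.length + 1) (Finset.Icc 1 w.length) := by
      ext; simp; omega
    rw [hI, Finset.sum_powerset_insert (by simp), splitSum_append_singleton, add_comm, ← ih, ← ih]
    congr 1
    · refine Finset.sum_congr rfl fun I _ => ?_
      rw [subword_append_singleton, subword_append_singleton]
      congr 1
      · rw [if_pos (by simp)]
        congr 1
        refine subword_congr w fun i hi => ?_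
        simp at hi ⊢; omega
      · rw [if_neg (by simp), List.append_nil]
        refine subword_congr w fun i hi => ?_
        simp at hi ⊢; omega
    · refine Finset.sum_congr rfl fun I hI => ?_
      have hn : w.length + 1 ∉ I := fun h => by
        have := Finset.mem_powerset.1 hI h
        simp at this
      rw [subword_append_singleton, subword_append_singleton]
      congr 1
      · rw [if_neg hn, List.append_nil]
      · rw [if_pos (by simp [hn])]
        congr 1
        refine subword_congr w fun i hi => ?_
        simp at hi ⊢; omega

theorem coprod_eq_splitSum (k : Type) [Field k] (w : Word) :
    coprod k w =
      splitSum w (fun u v => Finsupp.single (pack u, pack (quotWord v u)) (1 : k)) :=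
  sum_powerset_subword w fun u v => Finsupp.single (pack u, pack (quotWord v u)) (1 : k)

theorem coprod_sum (k : Type) [Field k] (w : Word) (h : Word × Word → k → M)
    (h_zero : ∀ p, h p 0 = 0) (h_add : ∀ p c d, h p (c + d) = h p c + h p d) :
    (coprod k w).sum h = splitSum w (fun u v => h (pack u, pack (quotWord v u)) 1) := by
  let F : (Word × Word →₀ k) →+ M :=
    { toFun := fun x => x.sum h
      map_zero' := Finsupp.sum_zero_index
      map_add' := fun _ _ => Finsupp.sum_add_index' h_zero h_add }
  rw [coprod_eq_splitSum]
  refine (map_splitSum F w _).trans ?_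
  congr 1
  funext u v
  exact Finsupp.sum_single_index (h_zero _)

end splitSum

theorem strictMonoOn_packMap (w : Word) : StrictMonoOn (packMap w) (insert 0 (IAlph w)) := by
  intro i _ j hj hij
  refine Finset.card_lt_card ((Finset.ssubset_iff_of_subset ?_).2 ⟨j, ?_, ?_⟩)
  · intro x hx
    simp only [Finset.mem_filter] at hx ⊢
    exact ⟨hx.1, hx.2.trans hij.le⟩
  · rcases hj with rfl | hj
    · omega
    · simp only [Finset.mem_filter, Finset.mem_erase]
      exact ⟨⟨by omega, hj⟩, le_rfl⟩
  · simp only [Finset.mem_filter]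
    omega

theorem pack_map {φ : ℕ → ℕ} {s : Finset ℕ} (hφ : StrictMonoOn φ (insert 0 (s : Set ℕ)))
    (h0 : φ 0 = 0) {x : Word} (hx : IAlph x ⊆ insert 0 s) : pack (x.map φ) = pack x := by
  have mem : ∀ i ∈ x, i ∈ insert 0 (s : Set ℕ) := fun i hi => by
    simpa using hx (List.mem_toFinset.2 hi)
  unfold pack subst
  rw [List.map_map]
  refine List.map_congr_left fun i hi => ?_
  rw [Function.comp_apply]
  unfold packMap
  refine (Finset.card_nbij φ ?_ ?_ ?_).symm
  · intro j hj
    simp only [IAlph, Finset.coe_filter, Set.mem_ofPred_eq,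
      Finset.mem_erase, List.mem_toFinset, List.mem_map] at hj ⊢
    obtain ⟨⟨hj0, hjx⟩, hji⟩ := hj
    refine ⟨⟨fun h => hj0 ?_, j, hjx, rfl⟩, (hφ.le_iff_le (mem j hjx) (mem i hi)).2 hji⟩
    exact hφ.injOn (mem j hjx) (Set.mem_insert _ _) (h.trans h0.symm)
  · refine hφ.injOn.mono fun j hj => mem j ?_
    simp only [IAlph, Finset.coe_filter, Set.mem_ofPred_eq, Finset.mem_erase,
      List.mem_toFinset] at hj
    exact hj.1.2
  · intro j hj
    simp only [IAlph, Finset.coe_filter, Set.mem_ofPred_eq, Finset.mem_erase,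
      List.mem_toFinset, List.mem_map, Set.mem_image] at hj ⊢
    obtain ⟨⟨hj0, l, hl, rfl⟩, hji⟩ := hj
    refine ⟨l, ⟨⟨?_, hl⟩, (hφ.le_iff_le (mem l hl) (mem i hi)).1 hji⟩, rfl⟩
    rintro rfl
    exact hj0 h0

theorem pack_quotWord_map {φ : ℕ → ℕ} {s : Finset ℕ} (hφ : StrictMonoOn φ (insert 0 (s : Set ℕ)))
    (h0 : φ 0 = 0) {x y : Word}
    (hx : IAlph x ⊆ insert 0 s) (hy : IAlph y ⊆ insert 0 s) :
    pack (quotWord (y.map φ) (x.map φ)) = pack (quotWord y x) := by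
  have hq : quotWord (y.map φ) (x.map φ) = (quotWord y x).map φ := by
    unfold quotWord quotSet subst
    rw [List.map_map, List.map_map]
    refine List.map_congr_left fun i hi => ?_
    have hi' : i ∈ insert 0 (s : Set ℕ) := by simpa using hy (List.mem_toFinset.2 hi)
    have : φ i ∈ IAlph (x.map φ) ↔ i ∈ IAlph x := by
      simp only [IAlph, List.mem_toFinset, List.mem_map]
      refine ⟨?_, fun h => ⟨i, h, rfl⟩⟩
      rintro ⟨j, hj, hji⟩
      have hj' : j ∈ insert 0 (s : Set ℕ) := by simpa using hx (List.mem_toFinset.2 hj)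
      rwa [← hφ.injOn hj' hi' hji]
    simp only [Function.comp_apply, this]
    split_ifs <;> simp [h0]
  rw [hq]
  refine pack_map hφ h0 fun i hi => ?_
  simp only [IAlph, quotWord, quotSet, subst, List.mem_toFinset, List.mem_map] at hi
  obtain ⟨j, hj, rfl⟩ := hi
  split_ifs
  · simp
  · exact hy (List.mem_toFinset.2 hj)

theorem quotWord_quotWord (y x u : Word) :
    quotWord (quotWord y u) (quotWord x u) = quotSet y (IAlph u ∪ IAlph x) := by
  unfold quotWord quotSet subst
  rw [List.map_map]
  refine List.map_congr_left fun i _ => ?_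
  by_cases hu : i ∈ IAlph u
  · simp [hu]
  · rcases eq_or_ne i 0 with rfl | hi
    · simp
    · have : i ∈ IAlph (x.map fun i => if i ∈ IAlph u then 0 else i) ↔ i ∈ IAlph x := by
        simp only [IAlph, List.mem_toFinset, List.mem_map] at hu ⊢
        refine ⟨?_, fun h => ⟨i, h, if_neg hu⟩⟩
        rintro ⟨j, hj, hji⟩
        split_ifs at hji with h
        · exact absurd hji.symm hi
        · rwa [← hji]
      simp [hu, this]

theorem IAlph_quotWord_subset {x v : Word} (u : Word) (h : IAlph x ⊆ IAlph v) :
    IAlph (quotWord x u) ⊆ IAlph (quotWord v u) := by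
  intro i hi
  simp only [IAlph, quotWord, quotSet, subst, List.mem_toFinset, List.mem_map] at hi ⊢
  obtain ⟨j, hj, rfl⟩ := hi
  exact ⟨j, List.mem_toFinset.1 (h (List.mem_toFinset.2 hj)), rfl⟩

/-- The coproduct `Δ` is coassociative: for every packed word `w`,
`(Δ ⊗ Id)(Δ w) = (Id ⊗ Δ)(Δ w)` in `H ⊗ H ⊗ H` (identified with the free vector space on
triples of words). -/
theorem coprod_coassoc (k : Type) [Field k] (w : Word) (hw : IsPacked w) :
    ((coprod k w).sum fun p c =>
        (coprod k p.1).sum fun q d => Finsupp.single (q.1, q.2, p.2) (c * d))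
      =
    ((coprod k w).sum fun p c =>
        (coprod k p.2).sum fun q d => Finsupp.single (p.1, q.1, q.2) (c * d)) := by
  rw [coprod_sum k w _ (by simp) (by simp [add_mul, Finsupp.sum_add]),
    coprod_sum k w _ (by simp) (by simp [add_mul, Finsupp.sum_add])]
  trans splitSum w fun u v => splitSum u fun x y =>
    Finsupp.single (pack x, pack (quotWord y x), pack (quotSet v (IAlph x ∪ IAlph y))) (1 : k)
  · congr 1
    funext u v
    rw [coprod_sum k _ _ (by simp) (by simp [mul_add])]
    refine (splitSum_map (packMap u) u _).trans (splitSum_congr u fun x y hxy => ?_)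
    have hx : IAlph x ⊆ insert 0 (IAlph u) := by rw [hxy]; grind
    have hy : IAlph y ⊆ insert 0 (IAlph u) := by rw [hxy]; grind
    rw [pack_map (strictMonoOn_packMap u) (packMap_zero u) hx,
      pack_quotWord_map (strictMonoOn_packMap u) (packMap_zero u) hx hy, ← hxy, mul_one]
    rfl
  rw [splitSum_assoc w fun x y v =>
    Finsupp.single (pack x, pack (quotWord y x), pack (quotSet v (IAlph x ∪ IAlph y))) (1 : k)]
  congr 1
  funext u v
  rw [coprod_sum k _ _ (by simp) (by simp [mul_add])]
  refine ((splitSum_map (packMap (quotWord v u)) (quotWord v u) _).trans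
    ((splitSum_map _ v _).trans (splitSum_congr v fun x y hxy => ?_))).symm
  have hx := (IAlph_quotWord_subset u (x := x) (v := v) (by rw [hxy]; grind)).trans
    (Finset.subset_insert 0 _)
  have hy := (IAlph_quotWord_subset u (x := y) (v := v) (by rw [hxy]; grind)).trans
    (Finset.subset_insert 0 _)
  have hp := pack_map (strictMonoOn_packMap (quotWord v u)) (packMap_zero _) hx
  have hq := pack_quotWord_map (strictMonoOn_packMap (quotWord v u)) (packMap_zero _) hx hy
  rw [quotWord_quotWord] at hq
  rw [← hp, ← hq, mul_one]
  rfl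
end

section
/- Let d_n denote the number of packed words of length n, so that d_n = Σ_{k=0}^{n} S(n+1,k+1)·k!. Then the exponential generating function of (d_n) satisfies Σ_{n≥0} d_n xⁿ/n! = eˣ/(2 − eˣ); equivalently, as an identity of formal power series, (2 − eˣ)·Σ_{n≥0} d_n xⁿ/n! = eˣ. -/
/-- Stirling numbers of the second kind: `stirling2 n k` is the number of set partitions of
an `n`-element set into exactly `k` nonempty blocks.  They satisfy `S(0,0) = 1`,
`S(n,0) = 0` for `n > 0`, `S(0,k) = 0` for `k > 0`, and
`S(n+1,k+1) = S(n,k) + (k+1)·S(n,k+1)`. -/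
def stirling2 : ℕ → ℕ → ℕ
  | 0, 0 => 1
  | 0, _ + 1 => 0
  | _ + 1, 0 => 0
  | n + 1, k + 1 => stirling2 n k + (k + 1) * stirling2 n (k + 1)

/-- The number `d_n` of packed words of length `n`. -/
noncomputable def dWords (n : ℕ) : ℕ := Nat.card {w : Word // IsPacked w ∧ w.length = n}

/-- The words of length `n` whose set of nonzero letters is `T` (for `0 ∉ T`). -/
def wordsOn : ℕ → Finset ℕ → Finset Word
  | 0, T => if T = ∅ then {[]} else ∅
  | n + 1, T => (insert 0 T).biUnion fun a =>
      (wordsOn n T ∪ wordsOn n (T.erase a)).image (List.cons a)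

theorem mem_wordsOn {n : ℕ} {T : Finset ℕ} (hT : 0 ∉ T) (w : Word) :
    w ∈ wordsOn n T ↔ w.length = n ∧ (IAlph w).erase 0 = T := by
  induction n generalizing T w with
  | zero =>
    rw [wordsOn, List.length_eq_zero_iff]
    split_ifs with h
    · subst h
      simp only [Finset.mem_singleton, iff_self_and]
      rintro rfl
      rfl
    · simp only [Finset.notMem_empty, false_iff, not_and]
      rintro rfl h'
      exact h h'.symm
  | succ n ih =>
    cases w with
    | nil => simp [wordsOn]
    | cons a v =>
      have hTa : 0 ∉ T.erase a := fun h => hT (Finset.mem_of_mem_erase h)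
      have hcons : (a :: v) ∈ wordsOn (n + 1) T ↔
          a ∈ insert 0 T ∧ (v ∈ wordsOn n T ∨ v ∈ wordsOn n (T.erase a)) := by
        simp only [wordsOn, Finset.mem_biUnion, Finset.mem_image, Finset.mem_union,
          List.cons.injEq]
        constructor
        · rintro ⟨b, hb, u, hu, rfl, rfl⟩
          exact ⟨hb, hu⟩
        · rintro ⟨ha, hv⟩
          exact ⟨a, ha, v, hv, rfl, rfl⟩
      rw [hcons, ih hT, ih hTa, ← and_or_left, List.length_cons, Nat.add_right_cancel_iff,
        and_left_comm]
      refine and_congr_right fun _ => ?_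
      simp only [IAlph, List.toFinset_cons, Finset.ext_iff, Finset.mem_erase, Finset.mem_insert,
        List.mem_toFinset]
      constructor
      · rintro ⟨ha, h | h⟩ i <;> specialize h i <;> grind
      · intro h
        refine ⟨by have := h a; grind, ?_⟩
        by_cases hav : a ∈ v
        · left; intro i; specialize h i; grind
        · right; intro i; specialize h i; grind

theorem stirling2_succ_succ (n k : ℕ) :
    stirling2 (n + 1) (k + 1) = stirling2 n k + (k + 1) * stirling2 n (k + 1) := rfl

theorem stirling2_eq_zero_of_lt {n k : ℕ} (h : n < k) : stirling2 n k = 0 := by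
  induction n generalizing k with
  | zero =>
    obtain ⟨k, rfl⟩ := Nat.exists_eq_succ_of_ne_zero (by omega : k ≠ 0)
    rfl
  | succ n ih =>
    obtain ⟨k, rfl⟩ := Nat.exists_eq_succ_of_ne_zero (by omega : k ≠ 0)
    rw [Nat.succ_eq_add_one, stirling2_succ_succ, ih (by omega), ih (by omega), mul_zero,
      add_zero]

theorem card_wordsOn_succ (n : ℕ) {T : Finset ℕ} (hT : 0 ∉ T) :
    (wordsOn (n + 1) T).card = (T.card + 1) * (wordsOn n T).card
      + ∑ a ∈ T, (wordsOn n (T.erase a)).card := by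
  rw [wordsOn, Finset.card_biUnion, Finset.sum_insert hT, Finset.erase_eq_of_notMem hT,
    Finset.union_self, Finset.card_image_of_injective _ List.cons_injective]
  · have hsum : ∀ a ∈ T, ((wordsOn n T ∪ wordsOn n (T.erase a)).image (List.cons a)).card =
        (wordsOn n T).card + (wordsOn n (T.erase a)).card := by
      intro a ha
      rw [Finset.card_image_of_injective _ List.cons_injective, Finset.card_union_of_disjoint]
      rw [Finset.disjoint_left]
      intro w hw hw'
      rw [mem_wordsOn hT] at hw
      rw [mem_wordsOn fun h => hT (Finset.mem_of_mem_erase h)] at hw'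
      exact Finset.notMem_erase a T (hw'.2 ▸ hw.2.symm ▸ ha)
    rw [Finset.sum_congr rfl hsum, Finset.sum_add_distrib, Finset.sum_const, smul_eq_mul]
    ring
  · intro a _ b _ hab
    simp only [Function.onFun, Finset.disjoint_left, Finset.mem_image]
    rintro _ ⟨u, _, rfl⟩ ⟨v, _, h⟩
    exact hab (List.cons.inj h).1.symm

theorem card_wordsOn (n : ℕ) {T : Finset ℕ} (hT : 0 ∉ T) :
    (wordsOn n T).card = stirling2 (n + 1) (T.card + 1) * T.card.factorial := by
  induction n generalizing T with
  | zero =>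
    rw [wordsOn]
    split_ifs with h
    · subst h
      rfl
    · have hpos := Finset.card_pos.2 (Finset.nonempty_iff_ne_empty.2 h)
      rw [stirling2_eq_zero_of_lt (by omega), zero_mul, Finset.card_empty]
  | succ n ih =>
    have hsum : ∀ a ∈ T, (wordsOn n (T.erase a)).card =
        stirling2 (n + 1) T.card * (T.card - 1).factorial := by
      intro a ha
      rw [ih fun h => hT (Finset.mem_of_mem_erase h), Finset.card_erase_of_mem ha,
        Nat.sub_add_cancel (Finset.card_pos.2 ⟨a, ha⟩)]
    rw [card_wordsOn_succ n hT, ih hT, Finset.sum_congr rfl hsum, Finset.sum_const, smul_eq_mul,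
      stirling2_succ_succ (n + 1)]
    rcases Nat.eq_zero_or_pos T.card with h | h
    · rw [h]
      simp [stirling2]
    · rw [← Nat.mul_factorial_pred h.ne']
      ring

theorem isPacked_iff_s18 (w : Word) :
    IsPacked w ↔ (IAlph w).erase 0 = Finset.Icc 1 ((IAlph w).erase 0).card := by
  have hfix : IsPacked w ↔ ∀ i ∈ w, packMap w i = i := by
    rw [IsPacked, pack, subst]
    conv_lhs => rhs; rw [← List.map_id w]
    exact List.map_inj_left
  rw [hfix]
  constructor
  · intro h
    refine Finset.eq_of_subset_of_card_le (fun i hi => ?_) (by simp)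
    have hi' := Finset.mem_erase.1 hi
    rw [Finset.mem_Icc]
    refine ⟨Nat.one_le_iff_ne_zero.2 hi'.1, ?_⟩
    conv_lhs => rw [← h i (List.mem_toFinset.1 hi'.2)]
    exact Finset.card_filter_le _ _
  · intro h i hi
    have hik : i ≤ ((IAlph w).erase 0).card := by
      rcases Nat.eq_zero_or_pos i with rfl | hpos
      · exact Nat.zero_le _
      · have hmem : i ∈ (IAlph w).erase 0 :=
          Finset.mem_erase.2 ⟨hpos.ne', List.mem_toFinset.2 hi⟩
        rw [h] at hmem
        exact (Finset.mem_Icc.1 hmem).2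
    have hfilter : ((IAlph w).erase 0).filter (fun j => j ≤ i) = Finset.Icc 1 i := by
      rw [h]
      ext j
      simp only [Finset.mem_filter, Finset.mem_Icc]
      omega
    rw [packMap, hfilter, Nat.card_Icc, Nat.add_sub_cancel]

theorem dWords_eq_sum_stirling2 (n : ℕ) :
    dWords n = ∑ j ∈ Finset.range (n + 1), stirling2 (n + 1) (j + 1) * j.factorial := by
  have h0 : ∀ k, 0 ∉ Finset.Icc 1 k := by simp
  have hmem : ∀ w : Word, w ∈ (Finset.range (n + 1)).biUnion
      (fun k => wordsOn n (Finset.Icc 1 k)) ↔ IsPacked w ∧ w.length = n := by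
    intro w
    simp only [Finset.mem_biUnion, Finset.mem_range, mem_wordsOn (h0 _), isPacked_iff_s18]
    constructor
    · rintro ⟨k, _, hn, hw⟩
      refine ⟨?_, hn⟩
      rw [hw, Nat.card_Icc, Nat.add_sub_cancel]
    · rintro ⟨hw, hn⟩
      refine ⟨_, ?_, hn, hw⟩
      have h₁ : ((IAlph w).erase 0).card ≤ (IAlph w).card := Finset.card_erase_le
      have h₂ : (IAlph w).card ≤ w.length := List.toFinset_card_le w
      omega
  rw [dWords, Nat.subtype_card _ hmem, Finset.card_biUnion]
  · refine Finset.sum_congr rfl fun k _ => ?_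
    rw [card_wordsOn n (h0 k), Nat.card_Icc, Nat.add_sub_cancel]
  · intro k _ l _ hkl
    simp only [Finset.disjoint_left, mem_wordsOn (h0 _), not_and]
    rintro w ⟨_, hk⟩ _ hl
    have := congrArg Finset.card (hk.symm.trans hl)
    simp only [Nat.card_Icc, Nat.add_sub_cancel] at this
    exact hkl this

open PowerSeries in
theorem coeff_exp_mul_exp_sub_one_pow (n k : ℕ) :
    coeff n (exp ℚ * (exp ℚ - 1) ^ k) * (n.factorial : ℚ)
      = (stirling2 (n + 1) (k + 1) * k.factorial : ℕ) := by
  induction n generalizing k with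
  | zero =>
    rw [coeff_zero_eq_constantCoeff_apply]
    cases k with
    | zero => simp [stirling2]
    | succ k => simp [stirling2_eq_zero_of_lt (by omega : 0 + 1 < k + 1 + 1)]
  | succ n ih =>
    have hsucc : ∀ f : ℚ⟦X⟧, coeff (n + 1) f * ((n + 1).factorial : ℚ)
        = coeff n (d⁄dX ℚ f) * (n.factorial : ℚ) := by
      intro f
      rw [coeff_derivative, Nat.factorial_succ]
      push_cast
      ring
    rw [hsucc]
    cases k with
    | zero =>
      have h := ih 0
      rw [pow_zero, mul_one] at h ⊢
      rw [derivative_exp, h, stirling2_succ_succ (n + 1)]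
      simp [stirling2]
    | succ k =>
      have hderiv : d⁄dX ℚ (exp ℚ * (exp ℚ - 1) ^ (k + 1)) =
          ((k + 2 : ℕ) : ℚ) • (exp ℚ * (exp ℚ - 1) ^ (k + 1)) +
          ((k + 1 : ℕ) : ℚ) • (exp ℚ * (exp ℚ - 1) ^ k) := by
        rw [Derivation.leibniz, derivative_pow, map_sub, derivative_exp, derivative_one]
        simp only [smul_eq_mul, smul_eq_C_mul, map_natCast]
        push_cast
        ring
      rw [hderiv, map_add, coeff_smul, coeff_smul, add_mul, smul_eq_mul, smul_eq_mul, mul_assoc,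
        mul_assoc, ih, ih, stirling2_succ_succ (n + 1), Nat.factorial_succ]
      push_cast
      ring

open PowerSeries in
theorem two_sub_exp_mul_sum_range (n : ℕ) :
    (2 - exp ℚ) * ∑ k ∈ Finset.range n, exp ℚ * (exp ℚ - 1) ^ k
      = exp ℚ - exp ℚ * (exp ℚ - 1) ^ n := by
  have h := mul_neg_geom_sum (exp ℚ - 1) n
  rw [← Finset.mul_sum]
  linear_combination exp ℚ * h

open PowerSeries in
theorem coeff_sum_range_exp_mul_pow {m n : ℕ} (hmn : m ≤ n) :
    coeff m (∑ k ∈ Finset.range (n + 1), exp ℚ * (exp ℚ - 1) ^ k)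
      = (dWords m : ℚ) / (m.factorial : ℚ) := by
  rw [eq_div_iff (by positivity), map_sum, Finset.sum_mul, dWords_eq_sum_stirling2]
  simp only [coeff_exp_mul_exp_sub_one_pow]
  rw [← Nat.cast_sum, Nat.cast_inj]
  refine (Finset.sum_subset (by simpa using hmn) fun k _ hk => ?_).symm
  rw [Finset.mem_range] at hk
  rw [stirling2_eq_zero_of_lt (by omega), zero_mul]

open PowerSeries in
theorem two_sub_exp_mul_egf_dWords :
    (2 - exp ℚ) * mk (fun n => (dWords n : ℚ) / (n.factorial : ℚ)) = exp ℚ := by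
  ext n
  have hdvd : (X : ℚ⟦X⟧) ^ (n + 1) ∣ exp ℚ * (exp ℚ - 1) ^ (n + 1) :=
    (pow_dvd_pow_of_dvd (X_dvd_iff.2 (by simp)) _).mul_left _
  have hn := congrArg (coeff n) (two_sub_exp_mul_sum_range (n + 1))
  rw [map_sub, X_pow_dvd_iff.1 hdvd n n.lt_succ_self, sub_zero] at hn
  rw [← hn, coeff_mul, coeff_mul]
  refine Finset.sum_congr rfl fun p hp => ?_
  have hle : p.2 ≤ n :=
    (Nat.le_add_left _ _).trans (Finset.HasAntidiagonal.mem_antidiagonal.1 hp).le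
  rw [coeff_mk, coeff_sum_range_exp_mul_pow hle]

/-- `d_n = Σ_{k=0}^{n} S(n+1,k+1)·k!`, and the exponential generating
function of `(d_n)` is `eˣ/(2 - eˣ)`, i.e. as formal power series
`(2 - eˣ)·Σ_{n≥0} d_n xⁿ/n! = eˣ`. -/
theorem egf_packed_words :
    (∀ n : ℕ, dWords n
        = ∑ j ∈ Finset.range (n + 1), stirling2 (n + 1) (j + 1) * Nat.factorial j) ∧
    (2 - PowerSeries.exp ℚ) *
        PowerSeries.mk (fun n => (dWords n : ℚ) / (Nat.factorial n : ℚ))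
      = PowerSeries.exp ℚ := by
  exact ⟨dWords_eq_sum_stirling2, two_sub_exp_mul_egf_dWords⟩
end
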